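/- arXiv:2103.13524 — 3 statements merged into one kernel-verified Lean document; each statement's English description precedes it below -/
import Mathlib

section
/- Let K be a finite abelian group and let A be a K-graded commutative ring that is gr-local with maximal graded ideal 𝔪. Then A is a local ring, and 𝔪 is its unique maximal ideal. -/
/-!
A `K`-graded commutative ring `A` (given by `𝒜 : K → AddSubgroup A` with `[GradedRing 𝒜]`)
is *gr-local with maximal graded ideal `m`* if:
* `A` is a Noetherian integral domain;
* `m` is a homogeneous ideal of `A` which is a maximal ideal;
* `𝒜 k ⊆ m` for every `k ≠ 0`;
* every element of the degree-zero part `𝒜 0` not lying in `m` is invertible in `𝒜 0`;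
* `A` is finitely generated as an algebra over its degree-zero subring
  (encoded as: `A` is generated as a ring by `𝒜 0` together with a finite set).

**Statement 0.** If `K` is a *finite* abelian group and `A` is gr-local with maximal graded
ideal `m`, then `A` is a local ring and `m` is its unique maximal ideal.
-/

/-- A ring graded by a finite group is integral over its degree-zero subring. -/
theorem GradedRing.isIntegral_gradeZero_of_finite
    {K : Type*} [AddCommGroup K] [Finite K] [DecidableEq K]
    {A : Type*} [CommRing A] (𝒜 : K → AddSubgroup A) [GradedRing 𝒜] :
    Algebra.IsIntegral (𝒜 0) A := by
  refine ⟨fun a => ?_⟩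
  classical
  rw [← DirectSum.sum_support_decompose 𝒜 a]
  refine IsIntegral.sum _ fun k _ => IsIntegral.of_pow (n := Nat.card K) Nat.card_pos ?_
  have hpow := SetLike.pow_mem_graded (Nat.card K) (DirectSum.decompose 𝒜 a k).2
  rw [card_nsmul_eq_zero'] at hpow
  exact isIntegral_algebraMap (R := 𝒜 0) (x := ⟨_, hpow⟩)

theorem gr_local_of_finite_grading_is_local
    {K : Type*} [AddCommGroup K] [Finite K] [DecidableEq K]
    {A : Type*} [CommRing A] [IsDomain A] [IsNoetherianRing A]
    (𝒜 : K → AddSubgroup A) [GradedRing 𝒜]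
    (m : Ideal A) (hmax : m.IsMaximal) (hhom : Ideal.IsHomogeneous 𝒜 m)
    (hcomp : ∀ k : K, k ≠ 0 → (𝒜 k : Set A) ⊆ (m : Set A))
    (hunit : ∀ a ∈ 𝒜 0, a ∉ m → ∃ b ∈ 𝒜 0, a * b = 1)
    (hfg : ∃ s : Finset A, Subring.closure ((𝒜 0 : Set A) ∪ (s : Set A)) = ⊤) :
    IsLocalRing A ∧ ∀ I : Ideal A, I.IsMaximal → I = m := by
  have hle : ∀ I : Ideal A, I.IsMaximal → I = m := by
    intro I hI
    have hint := GradedRing.isIntegral_gradeZero_of_finite 𝒜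
    have hI₀ : (I.comap (algebraMap (𝒜 0) A)).IsMaximal :=
      Ideal.isMaximal_comap_of_isIntegral_of_isMaximal I
    have hzero : I.comap (algebraMap (𝒜 0) A) = m.comap (algebraMap (𝒜 0) A) := by
      refine hI₀.eq_of_le (Ideal.comap_ne_top _ hmax.ne_top) fun x hx => ?_
      by_contra hxm
      obtain ⟨b, -, hb⟩ := hunit x x.2 hxm
      exact hI.ne_top ((Ideal.eq_top_iff_one I).2 (hb ▸ I.mul_mem_right b hx))
    have hmem : ∀ a ∈ 𝒜 0, a ∈ m → a ∈ I := fun a ha ham =>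
      hzero.ge (show (⟨a, ha⟩ : 𝒜 0) ∈ m.comap (algebraMap (𝒜 0) A) from ham)
    refine (hmax.eq_of_le hI.ne_top fun a ha => ?_).symm
    classical
    rw [← DirectSum.sum_support_decompose 𝒜 a]
    refine I.sum_mem fun k _ => hI.isPrime.mem_of_pow_mem (Nat.card K) (hmem _ ?_ ?_)
    · have hpow := SetLike.pow_mem_graded (Nat.card K) (DirectSum.decompose 𝒜 a k).2
      rwa [card_nsmul_eq_zero'] at hpow
    · exact m.pow_mem_of_mem (hhom k ha) _ Nat.card_pos
  exact ⟨IsLocalRing.of_unique_max_ideal ⟨m, hmax, hle⟩, hle⟩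
end

section
/- Let K be an abelian group and let A be a K-graded commutative ring that is gr-local with maximal graded ideal 𝔪. Let I be a homogeneous ideal of A and let a ∈ I be a homogeneous element. If the extension of I to the localization A_𝔪 of A at the maximal ideal 𝔪 is generated by the image of a (i.e., the ideal generated by the image of I in A_𝔪 equals the principal ideal generated by a/1), then I is the principal ideal of A generated by a. -/
/-!
**Statement 2.** Let `K` be an abelian group and `A` a `K`-graded commutative ring
(given by `𝒜 : K → AddSubgroup A` with `[GradedRing 𝒜]`) which is gr-local with maximal
graded ideal `m`, i.e.:
* `A` is a Noetherian integral domain;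
* `m` is a homogeneous maximal ideal;
* `𝒜 k ⊆ m` for every `k ≠ 0`;
* every element of `𝒜 0` not lying in `m` is invertible in `𝒜 0`;
* `A` is finitely generated as an algebra over `𝒜 0`.

Let `I` be a homogeneous ideal of `A` and `a ∈ I` a homogeneous element (of some degree `k`).
If the extension of `I` to the localization of `A` at `m` is the principal ideal generated by
the image of `a`, then `I = (a)` in `A`.
-/

theorem gr_local_principal_of_principal_after_localization
    {K : Type*} [AddCommGroup K] [DecidableEq K]
    {A : Type*} [CommRing A] [IsDomain A] [IsNoetherianRing A]
    (𝒜 : K → AddSubgroup A) [GradedRing 𝒜]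
    (m : Ideal A) (hmax : m.IsMaximal) (hhom : Ideal.IsHomogeneous 𝒜 m)
    (hcomp : ∀ k : K, k ≠ 0 → (𝒜 k : Set A) ⊆ (m : Set A))
    (hunit : ∀ a ∈ 𝒜 0, a ∉ m → ∃ b ∈ 𝒜 0, a * b = 1)
    (hfg : ∃ s : Finset A, Subring.closure ((𝒜 0 : Set A) ∪ (s : Set A)) = ⊤)
    (I : Ideal A) (hI : Ideal.IsHomogeneous 𝒜 I)
    (a : A) (haI : a ∈ I) (k : K) (ha : a ∈ 𝒜 k)
    (hloc :
      Ideal.map (algebraMap A (Localization (@Ideal.primeCompl A _ m hmax.isPrime))) I =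
        Ideal.span {algebraMap A (Localization (@Ideal.primeCompl A _ m hmax.isPrime)) a}) :
    I = Ideal.span {a} := by
  classical
  have := hmax.isPrime
  have hspan : (Ideal.span {a}).IsHomogeneous 𝒜 := by
    refine Ideal.homogeneous_span 𝒜 _ ?_
    rintro _ rfl
    exact ⟨k, ha⟩
  refine le_antisymm (fun y hy ↦ ?_) ((Ideal.span_singleton_le_iff_mem I).mpr haI)
  rw [← DirectSum.sum_support_decompose 𝒜 y]
  refine Ideal.sum_mem _ fun j _ ↦ ?_
  have hx : (DirectSum.decompose 𝒜 y j : A) ∈ I := hI j hy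
  have hxj : (DirectSum.decompose 𝒜 y j : A) ∈ 𝒜 j := SetLike.coe_mem _
  generalize (DirectSum.decompose 𝒜 y j : A) = x at hx hxj
  have hmap := Ideal.mem_map_of_mem (algebraMap A (Localization m.primeCompl)) hx
  rw [hloc, ← Set.image_singleton, ← Ideal.map_span,
    IsLocalization.algebraMap_mem_map_algebraMap_iff m.primeCompl] at hmap
  obtain ⟨s, hs, hsx⟩ := hmap
  have hs0x : (DirectSum.decompose 𝒜 s 0 : A) * x ∈ Ideal.span {a} := by
    have h := hspan j hsx
    rwa [← zero_add j, DirectSum.coe_decompose_mul_add_of_right_mem 𝒜 hxj] at h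
  have hs0 : (DirectSum.decompose 𝒜 s 0 : A) ∉ m := by
    intro h0
    refine hs ?_
    rw [← DirectSum.sum_support_decompose 𝒜 s]
    refine Ideal.sum_mem _ fun i _ ↦ ?_
    obtain rfl | hi := eq_or_ne i 0
    · exact h0
    · exact hcomp i hi (SetLike.coe_mem _)
  obtain ⟨b, -, hb⟩ := hunit _ (SetLike.coe_mem _) hs0
  have hbx := Ideal.mul_mem_left _ b hs0x
  rwa [← mul_assoc, mul_comm b, hb, one_mul] at hbx
end

section
/- Let r be a natural number and let A be a commutative ring graded by the free abelian group ℤ^r which is gr-local with maximal graded ideal 𝔪; write A₀ for the degree-zero subring and 𝔪₀ := 𝔪 ∩ A₀ for the maximal ideal of A₀ (powers 𝔪₀^n are computed as ideals of A₀). Then for every degree k ∈ ℤ^r and every n ∈ ℕ there exists m ∈ ℕ such that every element of A_k ∩ 𝔪^m can be written as a finite sum Σᵢ aᵢ xᵢ with aᵢ ∈ 𝔪₀^n and xᵢ ∈ A_k; conversely, every such finite sum Σᵢ aᵢ xᵢ with aᵢ ∈ 𝔪₀^n and xᵢ ∈ A_k lies in A_k ∩ 𝔪^n. In other words, the 𝔪-adic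 filtration and the 𝔪₀-adic filtration on each homogeneous component A_k are cofinal. -/
namespace SetLike.GradeZero

section Component

variable {ι A : Type*} [AddMonoid ι] [CommRing A]
  (𝒜 : ι → AddSubgroup A) [SetLike.GradedMonoid 𝒜]

/-- A homogeneous component of a graded ring, as a module over the degree-zero subring. -/
def component (k : ι) : Submodule (subring 𝒜) A where
  __ := 𝒜 k
  smul_mem' c x hx := by
    have h : (c : A) * x ∈ 𝒜 (0 + k) := SetLike.mul_mem_graded (A := 𝒜) c.2 hx
    rwa [zero_add] at h

theorem exists_sum_of_mem_ideal_smul_component {k : ι} {I : Ideal (subring 𝒜)} {x : A}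
    (hx : x ∈ I • component 𝒜 k) :
    ∃ (ℓ : ℕ) (a : Fin ℓ → subring 𝒜) (y : Fin ℓ → A),
      (∀ i, a i ∈ I) ∧ (∀ i, y i ∈ 𝒜 k) ∧ x = ∑ i, (a i : A) * y i := by
  induction hx using Submodule.smul_induction_on' with
  | smul c hc z hz =>
    exact ⟨1, fun _ => c, fun _ => z, fun _ => hc, fun _ => hz, by simp [Subring.smul_def]⟩
  | add x _ y _ hx hy =>
    obtain ⟨p, a, u, ha, hu, rfl⟩ := hx
    obtain ⟨q, b, v, hb, hv, rfl⟩ := hy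
    refine ⟨p + q, Fin.append a b, Fin.append u v, ?_, ?_, ?_⟩
    · exact fun i => i.addCases (by simpa using ha) (by simpa using hb)
    · exact fun i => i.addCases (by simpa using hu) (by simpa using hv)
    · simp [Fin.sum_univ_add]

end Component

section Graded

variable {ι A : Type*} [AddCancelMonoid ι] [DecidableEq ι] [CommRing A]
  (𝒜 : ι → AddSubgroup A) [GradedRing 𝒜]

theorem proj_mul_of_mem {k : ι} (b : A) {x : A} (hx : x ∈ 𝒜 k) :
    GradedRing.proj 𝒜 k (b * x) = GradedRing.proj 𝒜 0 b * x := by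
  have h := DirectSum.coe_decompose_mul_add_of_right_mem 𝒜 (i := 0) (a := b) hx
  rwa [zero_add] at h

theorem proj_mul_of_mem_zero {k : ι} (b : A) {a : A} (ha : a ∈ 𝒜 0) :
    GradedRing.proj 𝒜 k (a * b) = a * GradedRing.proj 𝒜 k b :=
  DirectSum.coe_decompose_mul_of_left_mem_zero 𝒜 ha

theorem proj_of_mem {k : ι} {x : A} (hx : x ∈ 𝒜 k) : GradedRing.proj 𝒜 k x = x :=
  DirectSum.decompose_of_mem_same 𝒜 hx

theorem proj_mem (k : ι) (x : A) : GradedRing.proj 𝒜 k x ∈ 𝒜 k :=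
  (DirectSum.decompose 𝒜 x k).2

theorem mem_of_mem_span_of_le_component {k : ι} {N : Submodule (subring 𝒜) A}
    (hN : N ≤ component 𝒜 k) {x : A} (hxk : x ∈ 𝒜 k) (hx : x ∈ Ideal.span (N : Set A)) :
    x ∈ N := by
  suffices h : ∀ b : A, GradedRing.proj 𝒜 k (b * x) ∈ N by
    simpa [proj_of_mem 𝒜 hxk] using h 1
  clear hxk
  induction hx using Submodule.span_induction with
  | mem y hy =>
    intro b
    rw [proj_mul_of_mem 𝒜 b (hN hy)]
    exact N.smul_mem ⟨_, proj_mem 𝒜 0 b⟩ hy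
  | zero => simp
  | add y z _ _ hy hz =>
    intro b
    rw [mul_add, map_add]
    exact N.add_mem (hy b) (hz b)
  | smul a y _ hy =>
    intro b
    rw [smul_eq_mul, ← mul_assoc]
    exact hy _

theorem proj_mem_smul_component {k : ι} {I : Ideal (subring 𝒜)} {x : A}
    (hx : x ∈ I.map (subring 𝒜).subtype) :
    GradedRing.proj 𝒜 k x ∈ I • component 𝒜 k := by
  suffices h : ∀ b : A, GradedRing.proj 𝒜 k (b * x) ∈ I • component 𝒜 k by
    simpa using h 1
  induction hx using Submodule.span_induction with
  | mem y hy =>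
    intro b
    obtain ⟨c, hc, rfl⟩ := hy
    rw [mul_comm, proj_mul_of_mem_zero 𝒜 b (a := (subring 𝒜).subtype c) c.2]
    exact Submodule.smul_mem_smul hc (proj_mem 𝒜 k b)
  | zero => simp
  | add y z _ _ hy hz =>
    intro b
    rw [mul_add, map_add]
    exact Submodule.add_mem _ (hy b) (hz b)
  | smul a y _ hy =>
    intro b
    rw [smul_eq_mul, ← mul_assoc]
    exact hy _

theorem ideal_smul_component_le_map (k : ι) (I : Ideal (subring 𝒜)) :
    (I • component 𝒜 k : Submodule (subring 𝒜) A) ≤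
      (I.map (subring 𝒜).subtype).restrictScalars (subring 𝒜) :=
  Submodule.smul_le.mpr fun _ hc z _ =>
    Ideal.mul_mem_right z _ (Ideal.mem_map_of_mem (subring 𝒜).subtype hc)

instance isNoetherian_component [IsNoetherianRing A] (k : ι) :
    IsNoetherian (subring 𝒜) (component 𝒜 k) := by
  let f : Submodule (subring 𝒜) (component 𝒜 k) → Ideal A := fun N =>
    Ideal.span (N.map (component 𝒜 k).subtype : Set A)
  have hf : ∀ N P, f N ≤ f P → N ≤ P := fun N P h x hx => by
    have hx' : (x : A) ∈ P.map (component 𝒜 k).subtype :=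
      mem_of_mem_span_of_le_component 𝒜 (Submodule.map_subtype_le _ _) x.2
        (h (Ideal.subset_span (Submodule.mem_map_of_mem hx)))
    simpa using hx'
  have hmono : Monotone f := fun N P h => Ideal.span_mono (Submodule.map_mono h)
  have hstrict : StrictMono f := fun N P h =>
    lt_of_le_not_ge (hmono h.le) fun h' => h.not_ge (hf _ _ h')
  exact isNoetherian_iff'.mpr hstrict.wellFoundedGT

instance isNoetherianRing_subring [IsNoetherianRing A] : IsNoetherianRing (subring 𝒜) :=
  isNoetherian_of_injective
    ({ toFun := fun c => ⟨c, c.2⟩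
       map_add' := fun _ _ => rfl
       map_smul' := fun _ _ => rfl } : subring 𝒜 →ₗ[subring 𝒜] component 𝒜 0)
    fun _ _ h => Subtype.ext (congrArg (fun z : component 𝒜 0 => (z : A)) h)

end Graded

end SetLike.GradeZero

theorem Ideal.isArtinianRing_quotient_pow {R : Type*} [CommRing R] [IsNoetherianRing R]
    (I : Ideal R) [hI : I.IsMaximal] (n : ℕ) : IsArtinianRing (R ⧸ I ^ n) := by
  rw [isArtinianRing_iff_isNoetherianRing_krullDimLE_zero]
  refine ⟨inferInstance, Ring.KrullDimLE.mk₀ fun P hP => ?_⟩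
  have hle : I ≤ P.comap (Ideal.Quotient.mk (I ^ n)) :=
    Ideal.IsPrime.le_of_pow_le (n := n) fun x hx => by
      simp [Ideal.mem_comap, Ideal.Quotient.eq_zero_iff_mem.mpr hx]
  have heq := hI.eq_of_le (Ideal.IsPrime.ne_top inferInstance) hle
  have : (P.comap (Ideal.Quotient.mk (I ^ n))).IsMaximal := heq ▸ hI
  rw [← Ideal.map_comap_of_surjective _ Ideal.Quotient.mk_surjective P]
  exact (Ideal.map_eq_top_or_isMaximal_of_surjective _ Ideal.Quotient.mk_surjective this).resolve_left
    (by rw [Ideal.map_comap_of_surjective _ Ideal.Quotient.mk_surjective]; exact hP.ne_top)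

theorem Ideal.isArtinian_quotient_pow_smul_top {R M : Type*} [CommRing R] [IsNoetherianRing R]
    [AddCommGroup M] [Module R M] [Module.Finite R M] (I : Ideal R) [I.IsMaximal] (n : ℕ) :
    IsArtinian R (M ⧸ (I ^ n • ⊤ : Submodule R M)) := by
  have := I.isArtinianRing_quotient_pow n
  have : Module.Finite (R ⧸ I ^ n) (M ⧸ (I ^ n • ⊤ : Submodule R M)) :=
    Module.Finite.of_restrictScalars_finite R _ _
  have : IsArtinian (R ⧸ I ^ n) (M ⧸ (I ^ n • ⊤ : Submodule R M)) := inferInstance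
  exact isArtinian_of_surjective_algebraMap (R := R ⧸ I ^ n) Ideal.Quotient.mk_surjective

theorem Ideal.exists_mem_sub_mul_mem_of_forall_mem_pow_sup {A : Type*} [CommRing A]
    [IsNoetherianRing A] {m J : Ideal A} {x : A} (hx : ∀ i : ℕ, x ∈ m ^ i ⊔ J) :
    ∃ u ∈ m, x - u * x ∈ J := by
  have h : Ideal.Quotient.mk J x ∈ (⨅ i : ℕ, m ^ i • ⊤ : Submodule A (A ⧸ J)) := by
    refine (Submodule.mem_iInf _).mpr fun i => ?_
    obtain ⟨y, hy, z, hz, rfl⟩ := Submodule.mem_sup.mp (hx i)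
    have : Ideal.Quotient.mk J (y + z) = y • (1 : A ⧸ J) := by
      rw [map_add, Ideal.Quotient.eq_zero_iff_mem.mpr hz, add_zero, Algebra.smul_def, mul_one]
      rfl
    rw [this]
    exact Submodule.smul_mem_smul hy trivial
  obtain ⟨u, hu⟩ := (m.mem_iInf_smul_pow_eq_bot_iff _).mp h
  refine ⟨u, u.2, ?_⟩
  rw [← Ideal.Quotient.eq_zero_iff_mem, map_sub, map_mul, sub_eq_zero]
  exact hu.symm

open SetLike.GradeZero in
/-- On a homogeneous component, the adic topology of a homogeneous ideal `m` is at least as fine as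
that of `m₀`. -/
theorem SetLike.GradeZero.exists_mem_pow_smul_component {ι A : Type*} [AddCancelMonoid ι]
    [DecidableEq ι] [CommRing A] [IsNoetherianRing A] (𝒜 : ι → AddSubgroup A) [GradedRing 𝒜]
    {m : Ideal A} (hm : m ≠ ⊤) (hhom : ∀ x ∈ m, GradedRing.proj 𝒜 0 x ∈ m)
    (hunit : ∀ a ∈ 𝒜 0, a ∉ m → ∃ b ∈ 𝒜 0, a * b = 1) (k : ι) (n : ℕ) :
    ∃ M : ℕ, ∀ x ∈ 𝒜 k, x ∈ m ^ M →
      x ∈ (m.comap (subring 𝒜).subtype) ^ n • component 𝒜 k := by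
  set I := m.comap (subring 𝒜).subtype
  have hmaxI : I.IsMaximal := by
    refine Ideal.isMaximal_iff.mpr ⟨fun h => hm (m.eq_top_iff_one.mpr h), ?_⟩
    intro J x _ hx hxJ
    obtain ⟨b, hb, hxb⟩ := hunit x x.2 hx
    have : x * ⟨b, hb⟩ = 1 := Subtype.ext hxb
    exact this ▸ J.mul_mem_right _ hxJ
  let C := component 𝒜 k
  have := I.isArtinian_quotient_pow_smul_top (M := C) n
  let f : ℕ → Submodule (subring 𝒜) C := fun i =>
    ((m ^ i).restrictScalars (subring 𝒜)).comap C.subtype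
  have hf : Antitone f := fun i j h x hx => Ideal.pow_le_pow_right h hx
  obtain ⟨M, hM⟩ := IsArtinian.monotone_stabilizes
    (⟨fun i => OrderDual.toDual ((f i).map (I ^ n • ⊤ : Submodule (subring 𝒜) C).mkQ),
      fun i j h => Submodule.map_mono (hf h)⟩ :
      ℕ →o (Submodule (subring 𝒜) (C ⧸ (I ^ n • ⊤ : Submodule (subring 𝒜) C)))ᵒᵈ)
  refine ⟨M, fun x hxk hxm => ?_⟩
  have hsup : ∀ i, x ∈ m ^ i ⊔ (I ^ n).map (subring 𝒜).subtype := by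
    intro i
    have hx : (I ^ n • ⊤ : Submodule (subring 𝒜) C).mkQ ⟨x, hxk⟩ ∈
        (f (max M i)).map (I ^ n • ⊤ : Submodule (subring 𝒜) C).mkQ := by
      have h := hM (max M i) (le_max_left _ _)
      have h' : (f M).map (I ^ n • ⊤ : Submodule (subring 𝒜) C).mkQ =
        (f (max M i)).map (I ^ n • ⊤ : Submodule (subring 𝒜) C).mkQ := h
      rw [← h']
      exact Submodule.mem_map_of_mem hxm
    obtain ⟨y, hy, hyx⟩ := hx
    have hsub : (⟨x, hxk⟩ - y : C) ∈ (I ^ n • ⊤ : Submodule (subring 𝒜) C) :=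
      (Submodule.Quotient.eq _).mp hyx.symm
    have hsub' : x - y ∈ I ^ n • C := by
      have := Submodule.mem_map_of_mem (f := C.subtype) hsub
      rwa [Submodule.map_smul'', Submodule.map_subtype_top] at this
    rw [← add_sub_cancel (y : A) x]
    exact Submodule.add_mem_sup (Ideal.pow_le_pow_right (le_max_right M i) hy)
      (ideal_smul_component_le_map 𝒜 k _ hsub')
  obtain ⟨u, hu, hux⟩ := Ideal.exists_mem_sub_mul_mem_of_forall_mem_pow_sup hsup
  have hproj := proj_mem_smul_component 𝒜 (k := k) hux
  rw [map_sub, proj_of_mem 𝒜 hxk, proj_mul_of_mem 𝒜 u hxk] at hproj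
  have hone : (1 : A) ∈ 𝒜 0 := SetLike.GradedOne.one_mem
  obtain ⟨b, hb, hub⟩ := hunit (1 - GradedRing.proj 𝒜 0 u)
    (sub_mem hone (proj_mem 𝒜 0 u)) fun h => hm <| m.eq_top_iff_one.mpr <| by
      simpa using m.add_mem h (hhom u hu)
  have hx : b * (x - GradedRing.proj 𝒜 0 u * x) = x := by linear_combination x * hub
  rw [← hx]
  exact Submodule.smul_mem _ (⟨b, hb⟩ : subring 𝒜) hproj

/-!
**Statement 3.** Let `A` be a commutative ring graded by `ℤ^r` (given by
`𝒜 : (Fin r → ℤ) → AddSubgroup A` with `[GradedRing 𝒜]`) which is gr-local with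
maximal graded ideal `m`:
* `A` is a Noetherian integral domain;
* `m` is a homogeneous maximal ideal;
* `𝒜 k ⊆ m` for every `k ≠ 0`;
* every element of `𝒜 0` not lying in `m` is invertible in `𝒜 0`;
* `A` is finitely generated as an algebra over `𝒜 0`.

Write `A₀` for the degree-zero subring `SetLike.GradeZero.subring 𝒜` and
`m₀ := m ∩ A₀` for the maximal ideal of `A₀` (so powers `m₀ ^ n` are ideals of `A₀`).

Then for every degree `k` and every `n : ℕ` there is `M : ℕ` such that every element of
`𝒜 k ∩ m ^ M` is a finite sum `∑ i, aᵢ * xᵢ` with `aᵢ ∈ m₀ ^ n` and `xᵢ ∈ 𝒜 k`;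
conversely, every such finite sum lies in `𝒜 k ∩ m ^ n`.
-/

theorem gr_local_adic_filtrations_cofinal_on_components
    {r : ℕ} {A : Type*} [CommRing A] [IsDomain A] [IsNoetherianRing A]
    (𝒜 : (Fin r → ℤ) → AddSubgroup A) [GradedRing 𝒜]
    (m : Ideal A) (hmax : m.IsMaximal) (hhom : Ideal.IsHomogeneous 𝒜 m)
    (hcomp : ∀ k : Fin r → ℤ, k ≠ 0 → (𝒜 k : Set A) ⊆ (m : Set A))
    (hunit : ∀ a ∈ 𝒜 0, a ∉ m → ∃ b ∈ 𝒜 0, a * b = 1)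
    (hfg : ∃ s : Finset A,
      Subring.closure ((𝒜 0 : Set A) ∪ (s : Set A)) = ⊤)
    (k : Fin r → ℤ) (n : ℕ) :
    (∃ M : ℕ, ∀ x ∈ 𝒜 k, x ∈ m ^ M →
      ∃ (ℓ : ℕ) (a : Fin ℓ → SetLike.GradeZero.subring 𝒜) (y : Fin ℓ → A),
        (∀ i, a i ∈ (Ideal.comap (SetLike.GradeZero.subring 𝒜).subtype m) ^ n) ∧
        (∀ i, y i ∈ 𝒜 k) ∧
        x = ∑ i, (a i : A) * y i) ∧
    (∀ (ℓ : ℕ) (a : Fin ℓ → SetLike.GradeZero.subring 𝒜) (y : Fin ℓ → A),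
      (∀ i, a i ∈ (Ideal.comap (SetLike.GradeZero.subring 𝒜).subtype m) ^ n) →
      (∀ i, y i ∈ 𝒜 k) →
      (∑ i, (a i : A) * y i) ∈ 𝒜 k ∧ (∑ i, (a i : A) * y i) ∈ m ^ n) := by
  refine ⟨?_, fun ℓ a y ha hy => ⟨?_, ?_⟩⟩
  · obtain ⟨M, hM⟩ := SetLike.GradeZero.exists_mem_pow_smul_component 𝒜 hmax.ne_top
      (fun x hx => hhom 0 hx) hunit k n
    exact ⟨M, fun x hxk hxm =>
      SetLike.GradeZero.exists_sum_of_mem_ideal_smul_component 𝒜 (hM x hxk hxm)⟩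
  · exact sum_mem fun i _ => (SetLike.GradeZero.component 𝒜 k).smul_mem (a i) (hy i)
  · exact sum_mem fun i _ => Ideal.mul_mem_right _ _ (Ideal.le_comap_pow _ n (ha i))
end
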